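/- Let N ≥ 3 be odd and φ ∈ ℝ^N. The global minimum value of F_φ over all θ ∈ ℝ^{N−1} (with θ_N = 0) equals N · (1 − max_{l ∈ ℤ} cos((Φ + 2πl)/N)), and it is attained at the stationary point with s_k ≡ (Φ + 2πl*)/N (mod 2π) for all k, where l* maximizes cos((Φ + 2πl)/N) over l ∈ ℤ. -/

import Mathlib

open Real Filter

/-- The variable `s k = φ k + θ (k+1) - θ k` (indices cyclic mod `N`,
0-based; paper index `k` corresponds to `k-1` here, so `s_N` is `sVar` at `lastIdx`). -/
noncomputable def sVar (N : ℕ) (hN : 0 < N) (φ θ : Fin N → ℝ) (k : Fin N) : ℝ :=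
  φ k + θ ⟨((k : ℕ) + 1) % N, Nat.mod_lt _ hN⟩ - θ k

/-- The lattice Landau gauge functional / random phase XY Hamiltonian
`F_φ(θ) = Σ_k (1 - cos(φ_k + θ_{k+1} - θ_k))` with periodic boundary conditions. -/
noncomputable def Fxy (N : ℕ) (hN : 0 < N) (φ θ : Fin N → ℝ) : ℝ :=
  ∑ k : Fin N, (1 - Real.cos (sVar N hN φ θ k))

/-- The index of the fixed site (paper site `N`). -/
def lastIdx (N : ℕ) (hN : 0 < N) : Fin N :=
  ⟨N - 1, Nat.sub_lt hN Nat.one_pos⟩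

/-- `θ` is a stationary point of `F_φ` regarded as a function of the free
coordinates `θ_1, …, θ_{N-1}` (0-based: coordinates `k` with `k < N-1`),
with `θ` at `lastIdx` held fixed: all partial derivatives vanish. -/
noncomputable def IsStationaryPt (N : ℕ) (hN : 0 < N) (φ θ : Fin N → ℝ) : Prop :=
  ∀ k : Fin N, (k : ℕ) < N - 1 →
    deriv (fun t : ℝ => Fxy N hN φ (Function.update θ k t)) (θ k) = 0

/-- The `(N-1) × (N-1)` tridiagonal matrix with entries
`δ_{ij}(c_{i-1} + c_i) - δ_{i-1,j} c_{i-1} - δ_{i+1,j} c_i`, where indices are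
0-based (paper index `i` ↦ `i-1`) and `c_0 := c_N` (cyclic predecessor). -/
noncomputable def hessC (N : ℕ) (hN : 0 < N) (c : Fin N → ℝ) :
    Matrix (Fin (N - 1)) (Fin (N - 1)) ℝ :=
  Matrix.of fun i j =>
    (if i = j then
        c ⟨((i : ℕ) + (N - 1)) % N, Nat.mod_lt _ hN⟩ +
          c ⟨(i : ℕ), lt_of_lt_of_le i.isLt (Nat.sub_le N 1)⟩
      else 0)
    - (if (i : ℕ) = (j : ℕ) + 1 then c ⟨((i : ℕ) + (N - 1)) % N, Nat.mod_lt _ hN⟩ else 0)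
    - (if (j : ℕ) = (i : ℕ) + 1 then c ⟨(i : ℕ), lt_of_lt_of_le i.isLt (Nat.sub_le N 1)⟩ else 0)

/-- The Hessian of `F_φ` (with the last coordinate fixed) at a configuration `θ`. -/
noncomputable def hessAt (N : ℕ) (hN : 0 < N) (φ θ : Fin N → ℝ) :
    Matrix (Fin (N - 1)) (Fin (N - 1)) ℝ :=
  hessC N hN fun k => Real.cos (sVar N hN φ θ k)

/-- `F_φ` as a function of the free coordinates only: the coordinate at
`lastIdx` is overwritten by `0`. -/
noncomputable def FxyFixed (N : ℕ) (hN : 0 < N) (φ : Fin N → ℝ) (η : Fin N → ℝ) : ℝ :=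
  Fxy N hN φ (Function.update η (lastIdx N hN) 0)

/-- The value `σ = (Φ + 2πl - π Σ_{k=1}^{N-1} q_k) / (1 + Σ_{k=1}^{N-1} (-1)^{q_k})`. -/
noncomputable def sigmaVal (N : ℕ) (hN : 0 < N) (φ : Fin N → ℝ) (q : Fin N → ℕ) (l : ℤ) : ℝ :=
  ((∑ k, φ k) + 2 * Real.pi * (l : ℝ)
      - Real.pi * ∑ k ∈ Finset.univ.erase (lastIdx N hN), (q k : ℝ)) /
    (1 + ∑ k ∈ Finset.univ.erase (lastIdx N hN), (-1 : ℝ) ^ (q k))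

/-- The constraint `∑ s ≡ Φ (mod 2π)` is encoded as `cos (∑ s - Φ) = 1`; the sum of cosines attains
its maximum under this constraint. -/
theorem exists_max_sum_cos {N : ℕ} (hN : 0 < N) (Φ : ℝ) :
    ∃ t : Fin N → ℝ, cos (∑ k, t k - Φ) = 1 ∧
      ∀ s : Fin N → ℝ, cos (∑ k, s k - Φ) = 1 → ∑ k, cos (s k) ≤ ∑ k, cos (t k) := by
  have reduce : ∀ s : Fin N → ℝ, cos (∑ k, s k - Φ) = 1 →
      ∃ t ∈ Set.Icc (fun _ : Fin N => (0 : ℝ)) (fun _ => 2 * π),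
        cos (∑ k, t k - Φ) = 1 ∧ ∑ k, cos (t k) = ∑ k, cos (s k) := by
    intro s hs
    refine ⟨fun k => s k - toIcoDiv two_pi_pos 0 (s k) * (2 * π), ⟨fun k => ?_, fun k => ?_⟩, ?_, ?_⟩
    · simpa using (sub_toIcoDiv_zsmul_mem_Ico two_pi_pos 0 (s k)).1
    · simpa using (sub_toIcoDiv_zsmul_mem_Ico two_pi_pos 0 (s k)).2.le
    · have h : ∑ k, (s k - toIcoDiv two_pi_pos 0 (s k) * (2 * π)) - Φ
          = ∑ k, s k - Φ - ((∑ k, toIcoDiv two_pi_pos 0 (s k) : ℤ) : ℝ) * (2 * π) := by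
        rw [Finset.sum_sub_distrib, ← Finset.sum_mul]
        push_cast
        ring
      rw [h, cos_sub_int_mul_two_pi, hs]
    · simp only [cos_sub_int_mul_two_pi]
  have hK : IsCompact (Set.Icc (fun _ : Fin N => (0 : ℝ)) (fun _ => 2 * π) ∩
      {t | cos (∑ k, t k - Φ) = 1}) :=
    isCompact_Icc.inter_right (isClosed_eq (by fun_prop) continuous_const)
  have hne : (Set.Icc (fun _ : Fin N => (0 : ℝ)) (fun _ => 2 * π) ∩
      {t | cos (∑ k, t k - Φ) = 1}).Nonempty := by
    obtain ⟨t, ht, ht1, -⟩ := reduce (fun _ => Φ / N) (by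
      have : (N : ℝ) ≠ 0 := by positivity
      simp [mul_div_cancel₀, this])
    exact ⟨t, ht, ht1⟩
  obtain ⟨t, ⟨-, ht⟩, hmax⟩ := hK.exists_isMaxOn hne
    (f := fun t : Fin N → ℝ => ∑ k, cos (t k)) (by fun_prop)
  refine ⟨t, ht, fun s hs => ?_⟩
  obtain ⟨r, hr, hr1, hr2⟩ := reduce s hs
  exact hr2 ▸ hmax ⟨hr, hr1⟩

theorem exists_eq_add_two_pi_of_cos_add_cos_max {a b : ℝ} (hpos : 0 < cos a + cos b)
    (h : ∀ u, cos (a + u) + cos (b - u) ≤ cos a + cos b) :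
    ∃ m : ℤ, a = b + 2 * π * m := by
  have h1 := h ((b - a) / 2)
  have h2 := h ((b - a) / 2 + π)
  rw [show a + (b - a) / 2 = (a + b) / 2 by ring, show b - (b - a) / 2 = (a + b) / 2 by ring] at h1
  rw [show a + ((b - a) / 2 + π) = (a + b) / 2 + π by ring,
    show b - ((b - a) / 2 + π) = (a + b) / 2 - π by ring, cos_add_pi, cos_sub_pi] at h2
  rw [← two_mul] at h1
  rw [cos_add_cos a b] at h1 h2 hpos
  set C := cos ((a + b) / 2)
  set D := cos ((a - b) / 2)
  have hCD : |C| ≤ C * D := abs_le'.2 ⟨by linarith, by linarith⟩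
  have hC : 0 < |C| := abs_pos.2 fun h0 => by simp [h0] at hpos
  have hD1 : 1 ≤ |D| := by
    have h3 : |C| * 1 ≤ |C| * |D| := by
      rw [mul_one, ← abs_mul]
      exact hCD.trans (le_abs_self _)
    exact le_of_mul_le_mul_left h3 hC
  have hsin : sin ((a - b) / 2) = 0 := by
    have h4 : 1 ≤ D ^ 2 := by
      rw [← sq_abs]
      nlinarith
    have h5 := sin_sq_add_cos_sq ((a - b) / 2)
    exact pow_eq_zero_iff two_ne_zero |>.1 (le_antisymm (by linarith) (sq_nonneg _))
  obtain ⟨m, hm⟩ := sin_eq_zero_iff.1 hsin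
  exact ⟨m, by linarith⟩

theorem sub_two_le_mul_cos_div {N : ℕ} (hN : 3 ≤ N) {x : ℝ} (hx : |x| ≤ π) :
    (N : ℝ) - 2 ≤ N * cos (x / N) := by
  have hN' : (3 : ℝ) ≤ N := by exact_mod_cast hN
  have hx2 : x ^ 2 ≤ 12 := by
    rw [← sq_abs]
    nlinarith [abs_nonneg x, pi_lt_d2]
  have h1 : (N : ℝ) * (1 - (x / N) ^ 2 / 2) ≤ N * cos (x / N) := by
    gcongr
    exact one_sub_sq_div_two_le_cos
  have h2 : (N : ℝ) * (1 - (x / N) ^ 2 / 2) = N - x ^ 2 / (2 * N) := by field_simp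
  have h3 : x ^ 2 / (2 * N) ≤ 2 := by
    rw [div_le_iff₀ (by positivity)]
    linarith
  linarith

theorem exists_abs_add_two_pi_le (Φ : ℝ) : ∃ l : ℤ, |Φ + 2 * π * l| ≤ π := by
  have h := sub_toIcoDiv_zsmul_mem_Ico two_pi_pos (-π) Φ
  refine ⟨-toIcoDiv two_pi_pos (-π) Φ, abs_le.2 ⟨?_, ?_⟩⟩
  · have := h.1
    simp only [zsmul_eq_mul] at this
    push_cast
    linarith
  · have := h.2
    simp only [zsmul_eq_mul] at this
    push_cast
    linarith

theorem exists_sum_cos_le {N : ℕ} (hN : 3 ≤ N) (Φ : ℝ) :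
    ∃ l : ℤ, ∀ s : Fin N → ℝ, cos (∑ k, s k - Φ) = 1 →
      ∑ k, cos (s k) ≤ N * cos ((Φ + 2 * π * l) / N) := by
  obtain ⟨t, ht, hmax⟩ := exists_max_sum_cos (N := N) (by omega) Φ
  by_cases hpair : ∀ i j, i ≠ j → 0 < cos (t i) + cos (t j)
  · have hshift : ∀ i j, i ≠ j → ∃ m : ℤ, t i = t j + 2 * π * m := by
      intro i j hij
      refine exists_eq_add_two_pi_of_cos_add_cos_max (hpair i j hij) fun u => ?_
      have hsplit : ∀ f : Fin N → ℝ,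
          ∑ k, f k = f i + f j + ∑ k ∈ (Finset.univ.erase i).erase j, f k := by
        intro f
        rw [← Finset.add_sum_erase _ f (Finset.mem_univ i),
          ← Finset.add_sum_erase _ f (Finset.mem_erase.2 ⟨hij.symm, Finset.mem_univ j⟩), add_assoc]
      let s := Function.update (Function.update t i (t i + u)) j (t j - u)
      have hsi : s i = t i + u := by simp [s, hij]
      have hsj : s j = t j - u := by simp [s]
      have hs : ∀ k ∈ (Finset.univ.erase i).erase j, s k = t k := by
        intro k hk
        simp only [Finset.mem_erase, Finset.mem_univ, and_true] at hk
        simp [s, hk.1, hk.2]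
      have hsum : ∑ k, s k = ∑ k, t k := by
        rw [hsplit s, hsplit t, Finset.sum_congr rfl hs, hsi, hsj]
        ring
      have h := hmax s (by rw [hsum, ht])
      rw [hsplit, hsplit (fun k => cos (t k)), hsi, hsj,
        Finset.sum_congr rfl fun k hk => congrArg cos (hs k hk)] at h
      linarith
    let i₀ : Fin N := ⟨0, by omega⟩
    have hshift₀ : ∀ k, ∃ m : ℤ, t k = t i₀ + 2 * π * m := by
      intro k
      by_cases hk : k = i₀
      · exact ⟨0, by simp [hk]⟩
      · exact hshift k i₀ hk
    choose m hm using hshift₀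
    obtain ⟨r, hr⟩ := (cos_eq_one_iff _).1 ht
    have hsum : ∑ k, t k = N * t i₀ + 2 * π * ((∑ k, m k : ℤ) : ℝ) := by
      rw [Finset.sum_congr rfl fun k _ => hm k, Finset.sum_add_distrib, ← Finset.mul_sum]
      simp
    have hN0 : (N : ℝ) ≠ 0 := by
      have : N ≠ 0 := by omega
      exact_mod_cast this
    refine ⟨r - ∑ k, m k, fun s hs => (hmax s hs).trans_eq ?_⟩
    have harg : (Φ + 2 * π * ((r - ∑ k, m k : ℤ) : ℝ)) / N = t i₀ := by
      rw [div_eq_iff hN0, Int.cast_sub]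
      linarith
    have hcos : ∀ k, cos (t k) = cos (t i₀) := by
      intro k
      rw [hm k, mul_comm (2 * π), cos_add_int_mul_two_pi]
    rw [harg, Finset.sum_congr rfl fun k _ => hcos k]
    simp
  · push Not at hpair
    obtain ⟨i, j, hij, hle⟩ := hpair
    obtain ⟨l, hl⟩ := exists_abs_add_two_pi_le Φ
    refine ⟨l, fun s hs => (hmax s hs).trans (le_trans ?_ (sub_two_le_mul_cos_div hN hl))⟩
    have hj : j ∈ Finset.univ.erase i := Finset.mem_erase.2 ⟨hij.symm, Finset.mem_univ j⟩
    rw [← Finset.add_sum_erase _ _ (Finset.mem_univ i), ← Finset.add_sum_erase _ _ hj]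
    have h : ∑ k ∈ (Finset.univ.erase i).erase j, cos (t k)
        ≤ ∑ k ∈ (Finset.univ.erase i).erase j, (1 : ℝ) :=
      Finset.sum_le_sum fun k _ => cos_le_one _
    rw [Finset.sum_const, Finset.card_erase_of_mem hj, Finset.card_erase_of_mem (Finset.mem_univ i),
      Finset.card_fin, Nat.sub_sub, nsmul_eq_mul, mul_one, Nat.cast_sub (by omega)] at h
    push_cast at h
    linarith

theorem sum_sVar (N : ℕ) (hN : 0 < N) (φ θ : Fin N → ℝ) :
    ∑ k, sVar N hN φ θ k = ∑ k, φ k := by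
  have hinj : Function.Injective
      fun k : Fin N => (⟨((k : ℕ) + 1) % N, Nat.mod_lt _ hN⟩ : Fin N) := by
    intro a b hab
    have h : (a : ℕ) + 1 ≡ b + 1 [MOD N] := congrArg Fin.val hab
    exact Fin.ext ((Nat.ModEq.add_right_cancel' 1 h).eq_of_lt_of_lt a.isLt b.isLt)
  have hperm : ∑ k : Fin N, θ ⟨((k : ℕ) + 1) % N, Nat.mod_lt _ hN⟩ = ∑ k, θ k :=
    (Finite.injective_iff_bijective.1 hinj).sum_comp θ
  simp only [sVar, Finset.sum_sub_distrib, Finset.sum_add_distrib, hperm]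
  ring

theorem Fxy_eq_sub_sum_cos (N : ℕ) (hN : 0 < N) (φ θ : Fin N → ℝ) :
    Fxy N hN φ θ = N - ∑ k, cos (sVar N hN φ θ k) := by
  simp [Fxy, Finset.sum_sub_distrib]

theorem isStationaryPt_of_forall_le {N : ℕ} {hN : 0 < N} {φ θ : Fin N → ℝ}
    (h : ∀ η, Fxy N hN φ θ ≤ Fxy N hN φ η) : IsStationaryPt N hN φ θ := by
  intro k _
  refine IsLocalMin.deriv_eq_zero (Eventually.of_forall fun t => ?_)
  simpa using h (Function.update θ k t)

theorem exists_sVar_eq_const (N : ℕ) (hN : 0 < N) (φ : Fin N → ℝ) (l : ℤ) :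
    ∃ θ : Fin N → ℝ, θ (lastIdx N hN) = 0 ∧ ∀ k, ∃ m : ℤ,
      sVar N hN φ θ k = ((∑ k, φ k) + 2 * π * (l : ℝ)) / N + 2 * π * m := by
  obtain ⟨n, rfl⟩ : ∃ n, N = n + 1 := ⟨N - 1, by omega⟩
  set σ := ((∑ k, φ k) + 2 * π * (l : ℝ)) / (n + 1 : ℕ) with hσ
  have hσ' : σ * (n + 1) = (∑ k, φ k) + 2 * π * l := by
    rw [hσ]
    push_cast
    field_simp
  let φ' : ℕ → ℝ := fun j => if h : j < n + 1 then φ ⟨j, h⟩ else 0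
  let A : ℕ → ℝ := fun k => ∑ j ∈ Finset.range k, (σ - φ' j)
  have hφ' : ∀ k : Fin (n + 1), φ' k = φ k := fun k => dif_pos k.isLt
  have hA : A (n + 1) = 2 * π * l := by
    simp only [A, Finset.sum_sub_distrib, ← Fin.sum_univ_eq_sum_range φ', hφ']
    simp only [Finset.sum_const, Finset.card_range, nsmul_eq_mul]
    push_cast
    linarith
  have hA_succ : ∀ k, A (k + 1) = A k + (σ - φ' k) := fun k => Finset.sum_range_succ _ _
  refine ⟨fun k => A k - A n, by simp [lastIdx], fun k => ?_⟩
  have hk := hA_succ k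
  rw [hφ'] at hk
  by_cases hlast : (k : ℕ) = n
  · refine ⟨-l, ?_⟩
    rw [hlast, hA] at hk
    have hA0 : A 0 = 0 := by simp [A]
    simp only [sVar, hlast, Nat.mod_self, hA0]
    push_cast
    linarith
  · refine ⟨0, ?_⟩
    have hlt : (k : ℕ) + 1 < n + 1 := by omega
    simp only [sVar, Nat.mod_eq_of_lt hlt, hk]
    push_cast
    ring

/-- for odd `N`, the global minimum value of `F_φ` over all
configurations with `θ_N = 0` equals `N (1 - max_{l ∈ ℤ} cos((Φ + 2πl)/N))`, and
it is attained at the stationary point with `s_k ≡ (Φ + 2πl*)/N (mod 2π)` for all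
`k`, where `l*` maximizes `cos((Φ + 2πl)/N)`. -/
theorem stmt13 (N : ℕ) (hN : 3 ≤ N) (hodd : Odd N) (φ : Fin N → ℝ) :
    ∃ lstar : ℤ,
      (∀ l : ℤ, Real.cos (((∑ k, φ k) + 2 * π * (l : ℝ)) / N) ≤
        Real.cos (((∑ k, φ k) + 2 * π * (lstar : ℝ)) / N)) ∧
      IsLeast {y : ℝ | ∃ θ : Fin N → ℝ, θ (lastIdx N (by omega)) = 0 ∧
          Fxy N (by omega) φ θ = y}
        ((N : ℝ) * (1 - Real.cos (((∑ k, φ k) + 2 * π * (lstar : ℝ)) / N))) ∧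
      ∃ θ : Fin N → ℝ, θ (lastIdx N (by omega)) = 0 ∧
        IsStationaryPt N (by omega) φ θ ∧
        (∀ k : Fin N, ∃ m : ℤ,
          sVar N (by omega) φ θ k = ((∑ k, φ k) + 2 * π * (lstar : ℝ)) / N + 2 * π * m) ∧
        Fxy N (by omega) φ θ =
          (N : ℝ) * (1 - Real.cos (((∑ k, φ k) + 2 * π * (lstar : ℝ)) / N)) := by
  obtain ⟨l, hl⟩ := exists_sum_cos_le hN (∑ k, φ k)
  have hN0 : (0 : ℝ) < N := by
    have : 0 < N := by omega
    exact_mod_cast this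
  obtain ⟨θ, hθ, hs⟩ := exists_sVar_eq_const N (by omega) φ l
  have hlower : ∀ η, (N : ℝ) * (1 - cos ((∑ k, φ k + 2 * π * (l : ℝ)) / N))
      ≤ Fxy N (by omega) φ η := by
    intro η
    have h := hl (sVar N (by omega) φ η) (by rw [sum_sVar, sub_self, cos_zero])
    rw [Fxy_eq_sub_sum_cos]
    linarith
  have hval : Fxy N (by omega) φ θ
      = (N : ℝ) * (1 - cos ((∑ k, φ k + 2 * π * (l : ℝ)) / N)) := by
    have hcos : ∀ k, cos (sVar N (by omega) φ θ k)
        = cos ((∑ k, φ k + 2 * π * (l : ℝ)) / N) := by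
      intro k
      obtain ⟨m, hm⟩ := hs k
      rw [hm, mul_comm (2 * π) (m : ℝ), cos_add_int_mul_two_pi]
    simp only [Fxy, hcos, Finset.sum_const, Finset.card_fin, nsmul_eq_mul]
  refine ⟨l, fun l' => ?_, ⟨⟨θ, hθ, hval⟩, ?_⟩, θ, hθ, ?_, hs, hval⟩
  · have h := hl (fun _ => (∑ k, φ k + 2 * π * (l' : ℝ)) / N) (by
      rw [Finset.sum_const, Finset.card_fin, nsmul_eq_mul, mul_div_cancel₀ _ hN0.ne',
        add_sub_cancel_left, mul_comm, cos_int_mul_two_pi])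
    rw [Finset.sum_const, Finset.card_fin, nsmul_eq_mul] at h
    exact le_of_mul_le_mul_left h hN0
  · rintro y ⟨η, -, rfl⟩
    exact hlower η
  · exact isStationaryPt_of_forall_le fun η => hval ▸ hlower η
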